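/- Let M, s, r_1,…,r_M be positive integers and set k = s + r_1 + ⋯ + r_M. Then ∑_{n=1}^∞ [∏_{j=1}^M H_n^{(r_j)}] / n^{s+1} belongs to 𝔷_{k+1}(1) (the ℚ-span of multiple zeta values of weight k+1), and ∑_{n=1}^∞ (-1)^n [∏_{j=1}^M H_n^{(r_j)}] / n^s belongs to 𝔷_k(2) (the ℚ-span of alternating multiple zeta values of weight k). -/

import Mathlib

open scoped Real
open MeasureTheory

noncomputable section

/-- Goncharov's multiple polylogarithm. -/
def MPL {n : ℕ} (a : Fin n → ℕ) (z : Fin n → ℂ) : ℂ :=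
  ∑' ℓ : {f : Fin n → ℕ // StrictAnti f ∧ ∀ i, 0 < f i},
    ∏ j, z j ^ (ℓ.1 j) / ((ℓ.1 j : ℂ) ^ (a j))

/-- `x` is a (convergent) multiple polylogarithm value of weight `k` at `N`-th roots of unity. -/
def IsCMZV (k N : ℕ) (x : ℂ) : Prop :=
  ∃ (n : ℕ) (a : Fin (n + 1) → ℕ) (z : Fin (n + 1) → ℂ),
    (∀ j, 0 < a j) ∧ (∀ j, z j ^ N = 1) ∧ (∑ j, a j = k) ∧
    ¬(a 0 = 1 ∧ z 0 = 1) ∧ x = MPL a z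

/-- The ℚ-vector space `𝔷_k(N)`. -/
def zspan (k N : ℕ) : Submodule ℚ ℂ := Submodule.span ℚ {x | IsCMZV k N x}

/-- Harmonic number of order `r`: `H_n^{(r)} = ∑_{k=1}^n 1/k^r`. -/
def H (r n : ℕ) : ℝ := ∑ k ∈ Finset.range n, (1 : ℝ) / (k + 1) ^ r

/-- Alternating harmonic number of order `r`: `H̄_n^{(r)} = ∑_{k=1}^n (-1)^{k-1}/k^r`. -/
def Hbar (r n : ℕ) : ℝ := ∑ k ∈ Finset.range n, (-1 : ℝ) ^ k / (k + 1) ^ r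

open Classical in
def TT (m n : ℕ) : Finset (Fin m → ℕ) :=
  (Fintype.piFinset fun _ => Finset.Ico 1 n).filter StrictAnti

lemma mem_TT {m n : ℕ} (f : Fin m → ℕ) :
    f ∈ TT m n ↔ (∀ i, 0 < f i ∧ f i < n) ∧ StrictAnti f := by
  simp [TT, Fintype.mem_piFinset, Nat.succ_le_iff]

lemma strictAnti_cons {m : ℕ} (k : ℕ) (g : Fin m → ℕ) :
    StrictAnti (Fin.cons k g : Fin (m+1) → ℕ) ↔ (∀ i, g i < k) ∧ StrictAnti g := by
  constructor
  · intro h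
    refine ⟨fun i => ?_, fun i j hij => ?_⟩
    · simpa using h (Fin.succ_pos i)
    · simpa using h (Fin.succ_lt_succ_iff.2 hij)
  · rintro ⟨h1, h2⟩ i j hij
    induction i using Fin.cases with
    | zero =>
      induction j using Fin.cases with
      | zero => exact absurd hij (lt_irrefl _)
      | succ j => simpa using h1 j
    | succ i =>
      induction j using Fin.cases with
      | zero => exact absurd hij (by simp)
      | succ j => simpa using h2 (Fin.succ_lt_succ_iff.1 hij)

/-- truncated nested sum -/
def SS {m : ℕ} (a : Fin m → ℕ) (n : ℕ) : ℝ :=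
  ∑ g ∈ TT m n, ∏ j, 1 / ((g j : ℝ) ^ a j)

lemma SS_zero (a : Fin 0 → ℕ) (n : ℕ) : SS a n = 1 := by
  have : TT 0 n = {Fin.elim0} := by
    ext f
    simp only [mem_TT, Finset.mem_singleton]
    constructor
    · intro _; exact Subsingleton.elim _ _
    · intro _; exact ⟨fun i => i.elim0, fun i => i.elim0⟩
  simp [SS, this]

lemma SS_nonneg {m : ℕ} (a : Fin m → ℕ) (n : ℕ) : 0 ≤ SS a n :=
  Finset.sum_nonneg fun _ _ => Finset.prod_nonneg fun _ _ => by positivity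

lemma SS_cons {m : ℕ} (b : ℕ) (hb : 0 < b) (a : Fin m → ℕ) (n : ℕ) :
    SS (Fin.cons b a : Fin (m+1) → ℕ) n = ∑ k ∈ Finset.range n, SS a k / (k : ℝ) ^ b := by
  have h0 : ∑ k ∈ Finset.range n, SS a k / (k : ℝ) ^ b
      = ∑ k ∈ Finset.Ico 1 n, SS a k / (k : ℝ) ^ b := by
    symm
    apply Finset.sum_subset
    · intro k hk; simp at hk ⊢; omega
    · intro k hk hk'
      have : k = 0 := by simp at hk hk'; omega
      subst this
      simp [hb.ne']
  rw [h0]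
  unfold SS
  simp_rw [Finset.sum_div]
  rw [Finset.sum_sigma']
  symm
  refine Finset.sum_bij' (fun p _ => (Fin.cons p.1 p.2 : Fin (m+1) → ℕ))
    (fun f _ => ⟨f 0, Fin.tail f⟩) ?_ ?_ ?_ ?_ ?_
  · rintro ⟨k, g⟩ h
    simp only [Finset.mem_sigma, Finset.mem_Ico, mem_TT] at h
    rw [mem_TT, strictAnti_cons]
    refine ⟨fun i => ?_, fun i => (h.2.1 i).2, h.2.2⟩
    induction i using Fin.cases with
    | zero => simp; omega
    | succ i => have := h.2.1 i; simp; omega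
  · intro f h
    rw [← Fin.cons_self_tail f, mem_TT, strictAnti_cons] at h
    simp only [Finset.mem_sigma, Finset.mem_Ico, mem_TT]
    have h00 := h.1 0
    simp only [Fin.cons_zero] at h00
    refine ⟨by omega, fun i => ⟨?_, h.2.1 i⟩, h.2.2⟩
    have := h.1 i.succ
    simpa using this.1
  · rintro ⟨k, g⟩ h; simp
  · intro f h; simp
  · rintro ⟨k, g⟩ h
    simp only [Fin.prod_univ_succ, Fin.cons_zero, Fin.cons_succ]
    ring

lemma sum_sqrt (n : ℕ) : ∑ k ∈ Finset.range n, 1 / √(k : ℝ) ≤ 3 * √(n : ℝ) := by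
  induction n with
  | zero => simp
  | succ n ih =>
    rw [Finset.sum_range_succ]
    rcases Nat.eq_zero_or_pos n with h | h
    · subst h; simp
    have hn : (1:ℝ) ≤ n := by exact_mod_cast h
    have h1 : 0 < √(n:ℝ) := by positivity
    have h2 := Real.sq_sqrt (show (0:ℝ) ≤ n by positivity)
    have h3 := Real.sq_sqrt (show (0:ℝ) ≤ (n:ℝ)+1 by positivity)
    have h4 : √((n:ℝ)+1) ≤ 2 * √(n:ℝ) := by
      rw [Real.sqrt_le_left (by positivity)]
      nlinarith
    have h5 : 1 / √(n:ℝ) ≤ 3 * (√((n:ℝ)+1) - √(n:ℝ)) := by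
      have h6 : 0 ≤ √((n:ℝ)+1) - √(n:ℝ) := sub_nonneg.2 (Real.sqrt_le_sqrt (by linarith))
      rw [div_le_iff₀ h1]
      nlinarith
    push_cast
    linarith

lemma SS_bound {m : ℕ} (a : Fin m → ℕ) (ha : ∀ j, 0 < a j) :
    ∃ C : ℝ, 0 ≤ C ∧ ∀ n : ℕ, 0 < n → SS a n ≤ C * √(n : ℝ) := by
  induction m with
  | zero =>
    refine ⟨1, zero_le_one, fun n hn => ?_⟩
    rw [SS_zero, one_mul, Real.one_le_sqrt]
    exact_mod_cast hn
  | succ m ih =>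
    obtain ⟨C, hC, h⟩ := ih (Fin.tail a) (fun j => ha _)
    refine ⟨C * 3, by positivity, fun n hn => ?_⟩
    rw [← Fin.cons_self_tail a, SS_cons _ (ha 0), mul_assoc]
    refine le_trans ?_ (mul_le_mul_of_nonneg_left (sum_sqrt n) hC)
    rw [Finset.mul_sum]
    refine Finset.sum_le_sum fun k _ => ?_
    rcases Nat.eq_zero_or_pos k with hk | hk
    · subst hk; simp [(ha 0).ne']
    have hk1 : (1:ℝ) ≤ k := by exact_mod_cast hk
    have h2 : (k:ℝ) ≤ (k:ℝ) ^ a 0 := le_self_pow₀ hk1 (ha 0).ne'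
    calc SS (Fin.tail a) k / (k:ℝ) ^ a 0 ≤ (C * √(k:ℝ)) / k :=
          div_le_div₀ (by positivity) (h k hk) (by positivity) h2
      _ = C * (1 / √(k:ℝ)) := by
          have := Real.mul_self_sqrt (show (0:ℝ) ≤ k by positivity)
          have h1 : 0 < √(k:ℝ) := by positivity
          field_simp
          nlinarith

lemma SS_summable {m : ℕ} (a : Fin m → ℕ) (ha : ∀ j, 0 < a j) (t : ℕ) (ht : 2 ≤ t) :
    Summable fun n : ℕ => SS a (n+1) / ((n + 1 : ℕ) : ℝ) ^ t := by
  obtain ⟨C, hC, h⟩ := SS_bound a ha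
  have h1 : Summable fun n : ℕ => C * (((n + 1 : ℕ) : ℝ) ^ (-(3/2) : ℝ)) := by
    apply Summable.mul_left
    rw [summable_nat_add_iff (f := fun n : ℕ => (n : ℝ) ^ (-(3/2) : ℝ)) 1]
    exact Real.summable_nat_rpow.2 (by norm_num)
  refine Summable.of_nonneg_of_le (fun n => div_nonneg (SS_nonneg _ _) (by positivity)) ?_ h1
  intro n
  set x : ℝ := ((n + 1 : ℕ) : ℝ) with hx
  have hx1 : 1 ≤ x := by rw [hx]; exact_mod_cast Nat.succ_pos n
  have hx0 : 0 < x := by linarith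
  calc SS a (n+1) / x ^ t ≤ (C * √x) / x ^ 2 :=
        div_le_div₀ (by positivity) (h _ (Nat.succ_pos n)) (by positivity)
          (pow_le_pow_right₀ hx1 ht)
    _ = C * x ^ (-(3/2) : ℝ) := by
        rw [show (-(3/2) : ℝ) = 1/2 - (2:ℕ) by norm_num, Real.rpow_sub hx0, Real.rpow_natCast,
          Real.sqrt_eq_rpow]
        ring

def eqv (m : ℕ) : (Σ n : ℕ, TT m (n+1)) ≃
    {f : Fin (m+1) → ℕ // StrictAnti f ∧ ∀ i, 0 < f i} where
  toFun p := ⟨Fin.cons (p.1+1) p.2.1, by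
    have h := (mem_TT _).1 p.2.2
    refine ⟨(strictAnti_cons _ _).2 ⟨fun i => (h.1 i).2, h.2⟩, fun i => ?_⟩
    induction i using Fin.cases with
    | zero => simp
    | succ i => simpa using (h.1 i).1⟩
  invFun f := ⟨f.1 0 - 1, ⟨Fin.tail f.1, by
    have h := f.2
    have h0 := h.2 0
    have h1 := h.1
    rw [← Fin.cons_self_tail f.1, strictAnti_cons] at h1
    rw [mem_TT, Nat.sub_add_cancel h0]
    exact ⟨fun i => ⟨h.2 _, h1.1 i⟩, h1.2⟩⟩⟩
  left_inv p := by
    obtain ⟨n, g, hg⟩ := p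
    exact Sigma.subtype_ext (by simp) (by simp)
  right_inv f := by
    apply Subtype.ext
    have h0 := f.2.2 0
    simp [Nat.sub_add_cancel h0]

lemma MPL_eq {m : ℕ} (a : Fin m → ℕ) (ha : ∀ j, 0 < a j) (t : ℕ) (ht : 2 ≤ t)
    (z : ℂ) (hz : ‖z‖ = 1) :
    MPL (Fin.cons t a : Fin (m+1) → ℕ) (Fin.cons z (fun _ => 1) : Fin (m+1) → ℂ)
      = ∑' n : ℕ, z ^ (n+1) * ((SS a (n+1) : ℂ) / ((n+1 : ℕ) : ℂ) ^ t) := by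
  unfold MPL
  rw [← (eqv m).tsum_eq]
  have key : ∀ p : (Σ n : ℕ, TT m (n+1)),
      (∏ j, (Fin.cons z (fun _ => 1) : Fin (m+1) → ℂ) j ^ ((eqv m p).1 j) /
        (((eqv m p).1 j : ℂ) ^ ((Fin.cons t a : Fin (m+1) → ℕ) j))) =
      z ^ (p.1+1) / ((p.1+1 : ℕ) : ℂ) ^ t * ((∏ j, 1 / ((p.2.1 j : ℝ) ^ a j) : ℝ) : ℂ) := by
    intro p
    simp [eqv, Fin.prod_univ_succ]
    simp only [div_eq_mul_inv, mul_inv]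
    ring
  simp_rw [key]
  have hs : Summable fun p : (Σ n : ℕ, TT m (n+1)) =>
      z ^ (p.1+1) / ((p.1+1 : ℕ) : ℂ) ^ t * ((∏ j, 1 / ((p.2.1 j : ℝ) ^ a j) : ℝ) : ℂ) := by
    apply Summable.of_norm
    rw [summable_sigma_of_nonneg (fun _ => norm_nonneg _)]
    refine ⟨fun n => Summable.of_finite, ?_⟩
    convert SS_summable a ha t ht using 2 with n
    rw [tsum_fintype]
    simp only [norm_mul, norm_div, norm_pow, hz, one_pow, Complex.norm_natCast]
    rw [← Finset.mul_sum, div_mul_eq_mul_div, one_mul]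
    congr 1
    rw [SS, ← Finset.sum_coe_sort (TT m (n+1))]
    refine Finset.sum_congr rfl fun g _ => ?_
    rw [Complex.norm_real, Real.norm_of_nonneg]
    exact Finset.prod_nonneg fun _ _ => by positivity
  rw [hs.tsum_sigma]
  refine tsum_congr fun n => ?_
  rw [tsum_fintype, SS, ← Finset.sum_coe_sort (TT m (n+1))]
  dsimp only
  rw [← Finset.mul_sum]
  push_cast
  ring

def VV (w : ℕ) : Submodule ℚ (ℕ → ℝ) :=
  Submodule.span ℚ {f | ∃ (m : ℕ) (a : Fin m → ℕ), (∀ j, 0 < a j) ∧ ∑ j, a j = w ∧ f = SS a}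

def UU (w : ℕ) : Submodule ℚ (ℕ → ℝ) :=
  Submodule.span ℚ {f | ∃ (m : ℕ) (a : Fin m → ℕ) (t : ℕ), (∀ j, 0 < a j) ∧ 2 ≤ t ∧
    ∑ j, a j + t = w ∧ f = fun n => SS a n / (n:ℝ) ^ t}

def opT (b : ℕ) : (ℕ → ℝ) →ₗ[ℚ] (ℕ → ℝ) where
  toFun f n := ∑ k ∈ Finset.range n, f k / (k : ℝ) ^ b
  map_add' f g := by
    ext n; simp [add_div, Finset.sum_add_distrib]
  map_smul' c f := by
    ext n; simp [Finset.smul_sum, Rat.smul_def, mul_div_assoc]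

def opD (b : ℕ) : (ℕ → ℝ) →ₗ[ℚ] (ℕ → ℝ) where
  toFun f n := f n / (n : ℝ) ^ b
  map_add' f g := by
    ext n; simp [add_div]
  map_smul' c f := by
    ext n; simp [Rat.smul_def, mul_div_assoc]

def opM (h : ℕ → ℝ) : (ℕ → ℝ) →ₗ[ℚ] (ℕ → ℝ) where
  toFun f n := f n * h n
  map_add' f g := by
    ext n; simp [add_mul]
  map_smul' c f := by
    ext n; simp [Rat.smul_def, mul_assoc]

lemma opT_mem {b w : ℕ} (hb : 0 < b) {f : ℕ → ℝ} (hf : f ∈ VV w) : opT b f ∈ VV (w + b) := by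
  have : VV w ≤ (VV (w+b)).comap (opT b) := by
    refine Submodule.span_le.2 ?_
    rintro f ⟨m, a, ha, hw, rfl⟩
    refine Submodule.subset_span ⟨m+1, Fin.cons b a, ?_, ?_, ?_⟩
    · intro j
      induction j using Fin.cases with
      | zero => simpa
      | succ j => simpa using ha j
    · simp [Fin.sum_univ_succ, hw, add_comm]
    · ext n
      rw [SS_cons b hb]; rfl
  exact this hf

lemma opD_mem {t w : ℕ} (ht : 2 ≤ t) {f : ℕ → ℝ} (hf : f ∈ VV w) : opD t f ∈ UU (w + t) := by
  have : VV w ≤ (UU (w+t)).comap (opD t) := by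
    refine Submodule.span_le.2 ?_
    rintro f ⟨m, a, ha, hw, rfl⟩
    exact Submodule.subset_span ⟨m, a, t, ha, ht, by rw [hw], rfl⟩
  exact this hf

def hh (r n : ℕ) : ℝ := ∑ k ∈ Finset.range n, 1 / (k : ℝ) ^ r

lemma stuffle (r : ℕ) (hr : 0 < r) {m : ℕ} (a : Fin m → ℕ) (ha : ∀ j, 0 < a j) :
    opM (hh r) (SS a) ∈ VV (∑ j, a j + r) := by
  have hSS : ∀ {m : ℕ} (a : Fin m → ℕ) (ha : ∀ j, 0 < a j), SS a ∈ VV (∑ j, a j) :=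
    fun a ha => Submodule.subset_span ⟨_, a, ha, rfl, rfl⟩
  induction m with
  | zero =>
    have : opM (hh r) (SS a) = opT r (SS a) := by
      ext n
      simp [opM, opT, SS_zero, hh]
    rw [this]
    exact opT_mem hr (hSS a ha)
  | succ m ih =>
    have hc : SS a = opT (a 0) (SS (Fin.tail a)) := by
      ext n
      conv_lhs => rw [← Fin.cons_self_tail a]
      rw [SS_cons _ (ha 0)]; rfl
    have hsum : ∑ j, a j = ∑ j, Fin.tail a j + a 0 := by
      rw [Fin.sum_univ_succ, add_comm]; rfl
    have ha' : ∀ j, 0 < Fin.tail a j := fun j => ha _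
    have key : opM (hh r) (SS a) = opT (a 0) (opM (hh r) (SS (Fin.tail a))) + opT r (SS a)
        + opT (a 0 + r) (SS (Fin.tail a)) := by
      ext n
      induction n with
      | zero => simp [opM, opT, hh]
      | succ n ihn =>
        have e1 : SS a (n+1) = SS a n + SS (Fin.tail a) n / (n:ℝ) ^ a 0 := by
          rw [hc]; simp [opT, Finset.sum_range_succ]
        have e2 : hh r (n+1) = hh r n + 1 / (n:ℝ) ^ r := by
          simp [hh, Finset.sum_range_succ]
        simp only [opM, opT, Pi.add_apply, LinearMap.coe_mk, AddHom.coe_mk,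
          Finset.sum_range_succ] at ihn ⊢
        rw [e1, e2]
        have : (SS a n + SS (Fin.tail a) n / (n:ℝ) ^ a 0) * (hh r n + 1 / (n:ℝ) ^ r)
          = SS a n * hh r n + SS (Fin.tail a) n * hh r n / (n:ℝ) ^ a 0 + SS a n / (n:ℝ) ^ r
            + SS (Fin.tail a) n / (n:ℝ) ^ (a 0 + r) := by
          rw [pow_add]
          simp only [div_eq_mul_inv, mul_inv]
          ring
        rw [this, ihn]
        ring
    rw [key]
    refine add_mem (add_mem ?_ ?_) ?_
    · have := opT_mem (ha 0) (ih (Fin.tail a) ha')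
      rwa [show ∑ j, a j + r = ∑ j, Fin.tail a j + r + a 0 by rw [hsum]; ring]
    · exact opT_mem hr (hSS a ha)
    · have := opT_mem (b := a 0 + r) (by omega) (hSS (Fin.tail a) ha')
      rwa [show ∑ j, a j + r = ∑ j, Fin.tail a j + (a 0 + r) by rw [hsum]; ring]

lemma H_eq (r : ℕ) (hr : 0 < r) (n : ℕ) : H r n = hh r n + 1 / (n:ℝ) ^ r := by
  have h1 := Finset.sum_range_succ (fun k : ℕ => 1 / (k:ℝ) ^ r) n
  have h2 := Finset.sum_range_succ' (fun k : ℕ => 1 / (k:ℝ) ^ r) n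
  simp only [Nat.cast_zero, zero_pow hr.ne', div_zero, add_zero, Nat.cast_add, Nat.cast_one] at h2
  unfold H hh
  rw [← h2, h1]

lemma UU_mul_H {w r : ℕ} (hr : 0 < r) {f : ℕ → ℝ} (hf : f ∈ UU w) :
    opM (H r) f ∈ UU (w + r) := by
  have : UU w ≤ (UU (w+r)).comap (opM (H r)) := by
    refine Submodule.span_le.2 ?_
    rintro f ⟨m, a, t, ha, ht, hw, rfl⟩
    have e : opM (H r) (fun n => SS a n / (n:ℝ) ^ t)
        = opD t (opM (hh r) (SS a)) + opD (t + r) (SS a) := by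
      ext n
      simp only [opM, opD, Pi.add_apply, LinearMap.coe_mk, AddHom.coe_mk, H_eq r hr]
      rw [pow_add]
      simp only [div_eq_mul_inv, mul_inv]
      ring
    change opM (H r) (fun n => SS a n / (n:ℝ) ^ t) ∈ UU (w + r)
    rw [e]
    refine add_mem ?_ ?_
    · have := opD_mem ht (stuffle r hr a ha)
      rwa [show w + r = ∑ j, a j + r + t by omega]
    · have := opD_mem (t := t + r) (by omega)
        (Submodule.subset_span ⟨_, a, ha, rfl, rfl⟩ : SS a ∈ VV (∑ j, a j))
      rwa [show w + r = ∑ j, a j + (t + r) by omega]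
  exact this hf

lemma prodH_mem (t : ℕ) (ht : 2 ≤ t) (M : ℕ) (r : Fin M → ℕ) (hr : ∀ j, 0 < r j) :
    (fun n : ℕ => (∏ j, H (r j) n) / (n:ℝ) ^ t) ∈ UU (t + ∑ j, r j) := by
  induction M with
  | zero =>
    refine Submodule.subset_span ⟨0, r, t, hr, ht, by simp, ?_⟩
    ext n; simp [SS_zero]
  | succ M ih =>
    have := UU_mul_H (hr 0) (ih (fun j => r j.succ) (fun j => hr _))
    rw [Fin.sum_univ_succ, show t + (r 0 + ∑ j : Fin M, r j.succ) = t + ∑ j : Fin M, r j.succ + r 0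
      by ring]
    convert this using 1
    ext n
    simp only [opM, LinearMap.coe_mk, AddHom.coe_mk, Fin.prod_univ_succ]
    ring

lemma UU_tsum {w N : ℕ} (z : ℂ) (hz : ‖z‖ = 1) (hzN : z ^ N = 1) {f : ℕ → ℝ} (hf : f ∈ UU w) :
    Summable (fun n : ℕ => z ^ (n+1) * (f (n+1) : ℂ)) ∧
      ∑' n : ℕ, z ^ (n+1) * (f (n+1) : ℂ) ∈ zspan w N := by
  induction hf using Submodule.span_induction with
  | mem f hf =>
    obtain ⟨m, a, t, ha, ht, hw, rfl⟩ := hf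
    constructor
    · apply Summable.of_norm
      convert SS_summable a ha t ht using 2 with n
      rw [norm_mul, norm_pow, hz, one_pow, one_mul, Complex.norm_real, Real.norm_of_nonneg]
      exact div_nonneg (SS_nonneg _ _) (by positivity)
    · refine Submodule.subset_span ⟨m, Fin.cons t a, Fin.cons z (fun _ => 1), ?_, ?_, ?_, ?_, ?_⟩
      · intro j
        induction j using Fin.cases with
        | zero => simp; omega
        | succ j => simpa using ha j
      · intro j
        induction j using Fin.cases with
        | zero => simpa
        | succ j => simp
      · simp [Fin.sum_univ_succ]; omega
      · simp; omega
      · rw [MPL_eq a ha t ht z hz]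
        push_cast
        rfl
  | zero => simp [summable_zero]
  | add f g _ _ hf hg =>
    have e : (fun n : ℕ => z ^ (n+1) * (((f + g) (n+1) : ℝ) : ℂ))
      = fun n => z ^ (n+1) * (f (n+1) : ℂ) + z ^ (n+1) * (g (n+1) : ℂ) := by
      ext n; simp [mul_add]
    rw [e]
    refine ⟨hf.1.add hg.1, ?_⟩
    rw [hf.1.tsum_add hg.1]
    exact add_mem hf.2 hg.2
  | smul c f _ hf =>
    have e : (fun n : ℕ => z ^ (n+1) * (((c • f) (n+1) : ℝ) : ℂ))
      = fun n => (c : ℂ) * (z ^ (n+1) * (f (n+1) : ℂ)) := by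
      ext n; simp [Rat.smul_def]; ring
    rw [e]
    refine ⟨hf.1.mul_left _, ?_⟩
    rw [tsum_mul_left, ← Rat.smul_def]
    exact Submodule.smul_mem _ _ hf.2

lemma one_le_H (r n : ℕ) : 1 ≤ H r (n+1) := by
  unfold H
  rw [Finset.sum_range_succ']
  simp only [Nat.cast_zero, zero_add, one_pow, div_one]
  have : 0 ≤ ∑ k ∈ Finset.range n, (1:ℝ) / (((k+1 : ℕ) : ℝ) + 1) ^ r :=
    Finset.sum_nonneg fun _ _ => by positivity
  linarith

/-- Nonlinear Euler sums: for positive integers `M, s, r_1,…,r_M` and `k = s + r_1 + ⋯ + r_M`,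
`∑_{n=1}^∞ (∏_j H_n^{(r_j)})/n^{s+1} ∈ 𝔷_{k+1}(1)` and
`∑_{n=1}^∞ (-1)^n (∏_j H_n^{(r_j)})/n^s ∈ 𝔷_k(2)`. -/
theorem nonlinear_euler_sums (M s : ℕ) (hM : 0 < M) (hs : 0 < s)
    (r : Fin M → ℕ) (hr : ∀ j, 0 < r j) :
    (∑' n : ℕ, (∏ j, (H (r j) (n + 1) : ℂ)) / ((n : ℂ) + 1) ^ (s + 1)) ∈
        zspan (s + ∑ j, r j + 1) 1 ∧
    (∑' n : ℕ, (-1 : ℂ) ^ (n + 1) * (∏ j, (H (r j) (n + 1) : ℂ)) / ((n : ℂ) + 1) ^ s) ∈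
        zspan (s + ∑ j, r j) 2 := by
  constructor
  · have := (UU_tsum (N := 1) 1 (by simp) (by simp) (prodH_mem (s+1) (by omega) M r hr)).2
    rw [show s + ∑ j, r j + 1 = s + 1 + ∑ j, r j by ring]
    convert this using 3 with n
    simp
  · rcases Nat.lt_or_ge s 2 with h | h
    · -- `s = 1`: the series is only conditionally convergent, so the unconditional `tsum` is `0`.
      have hs1 : s = 1 := by omega
      subst hs1
      rw [tsum_eq_zero_of_not_summable]
      · exact zero_mem _
      · intro hsum
        have h1 : Summable fun n : ℕ => 1 / ((n + 1 : ℕ) : ℝ) := by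
          refine Summable.of_nonneg_of_le (fun n => by positivity) ?_ hsum.norm
          intro n
          have e : ‖(n:ℂ) + 1‖ = ((n+1 : ℕ) : ℝ) := by
            rw [← Complex.norm_natCast]; push_cast; rfl
          rw [norm_div, norm_mul, norm_pow, norm_neg, norm_one, one_pow, one_mul, pow_one, e,
            norm_prod]
          gcongr
          rw [← Finset.prod_const_one (s := (Finset.univ : Finset (Fin M)))]
          refine Finset.prod_le_prod (fun _ _ => zero_le_one) ?_
          intro j _
          rw [Complex.norm_real]
          exact (one_le_H _ _).trans (le_abs_self _)
        rw [summable_nat_add_iff (f := fun n : ℕ => 1 / (n : ℝ)) 1] at h1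
        exact Real.not_summable_one_div_natCast h1
    · have := (UU_tsum (N := 2) (-1) (by simp) (by norm_num) (prodH_mem s h M r hr)).2
      convert this using 3 with n
      push_cast
      ring
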